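/- arXiv:2507.15123 — 6 statements merged into one kernel-verified Lean document; each statement's English description precedes it below -/
import Mathlib

section
/- Let ⟨k_i : i ∈ ℕ⟩ be a strictly increasing sequence of naturals with k_0 = 0 (so the intervals [k_i, k_{i+1}) partition ℕ). Let n ≥ 1, let U_0,…,U_{n−1} be pairwise non-isomorphic Ramsey ultrafilters on ℕ, and let E be a Q-point on ℕ that is not isomorphic to any U_k. Then there exist sets Y_k ∈ U_k for each k < n and a set v ∈ E such that for every i ≥ 2 and every k < n: if Y_k ∩ [k_{i-1}, k_i) ≠ ∅, then v ∩ [k_{i-2}, k_{i-1}) = ∅, v ∩ [k_{i-1}, k_i) = ∅, and v ∩ [k_i, k_{i+1}) = ∅ (i.e., v and the Y_k do not intersect equal or adjacent intervals of the partition). -/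
/-- A (ultra)filter is free if it contains no finite set, equivalently
every member is infinite. -/
def FreeUf {S : Type} (U : Ultrafilter S) : Prop := ∀ A ∈ U, Set.Infinite A

/-- Isomorphism of ultrafilters: some bijection maps one to the other. -/
def UfIso {S T : Type} (U : Ultrafilter S) (V : Ultrafilter T) : Prop :=
  ∃ f : S ≃ T, Ultrafilter.map f U = V

/-- A Ramsey ultrafilter on ℕ: free, and every 2-coloring of pairs has a
monochromatic member. -/
def IsRamseyUf (U : Ultrafilter ℕ) : Prop :=
  FreeUf U ∧ ∀ c : ℕ → ℕ → Fin 2, ∃ A : Set ℕ, A ∈ U ∧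
    ∃ j : Fin 2, ∀ x ∈ A, ∀ y ∈ A, x < y → c x y = j

/-- A Q-point on ℕ: free, and for every partition of ℕ into finite sets
(encoded as a finite-to-one function, whose fibers are the pieces) there is a
member meeting each piece in at most one point. -/
def IsQPointUf (U : Ultrafilter ℕ) : Prop :=
  FreeUf U ∧ ∀ f : ℕ → ℕ, (∀ m, (f ⁻¹' {m}).Finite) →
    ∃ A : Set ℕ, A ∈ U ∧ Set.InjOn f A

/-- A map injective on a member of a free ultrafilter on `ℕ` is an isomorphism onto its image. -/
theorem ufIso_map_of_injOn {U : Ultrafilter ℕ} (hU : FreeUf U) {f : ℕ → ℕ} {A : Set ℕ}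
    (hA : A ∈ U) (hf : Set.InjOn f A) : UfIso U (U.map f) := by
  obtain ⟨B, C, hBC, hd, hBi, hCi⟩ : ∃ B C : Set ℕ, B ∪ C = A ∧ Disjoint B C ∧
      B.Infinite ∧ C.Infinite := by
    obtain ⟨B, C, rfl, hd, hcard⟩ := (hU A hA).exists_union_disjoint_cardinal_eq_of_infinite
    obtain ⟨e⟩ := Cardinal.eq.1 hcard
    have hiff : B.Infinite ↔ C.Infinite := by
      rw [← Set.infinite_coe_iff, ← Set.infinite_coe_iff, e.infinite_iff]
    have hor := Set.infinite_union.1 (hU _ hA)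
    exact ⟨B, C, rfl, hd, hor.elim id hiff.2, hor.elim hiff.1 id⟩
  wlog hB : B ∈ U generalizing B C
  · refine this C B (by rw [Set.union_comm, hBC]) hd.symm hCi hBi ?_
    rw [← hBC, Ultrafilter.union_mem_iff] at hA
    exact hA.resolve_left hB
  have hBA : B ⊆ A := hBC ▸ Set.subset_union_left
  have hCA : C ⊆ A := hBC ▸ Set.subset_union_right
  have : Infinite {x // ¬ x ∈ B} :=
    (hCi.mono fun x hx hxB => Set.disjoint_left.1 hd hxB hx : (Bᶜ).Infinite).to_subtype
  have : Infinite {x // ¬ x ∈ f '' B} := by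
    refine ((hCi.image (hf.mono hCA)).mono ?_ : ((f '' B)ᶜ).Infinite).to_subtype
    rintro _ ⟨x, hx, rfl⟩ ⟨y, hy, hxy⟩
    exact Set.disjoint_left.1 hd hy (hf (hBA hy) (hCA hx) hxy ▸ hx)
  obtain ⟨e⟩ : Nonempty ({x // ¬ x ∈ B} ≃ {x // ¬ x ∈ f '' B}) :=
    nonempty_equiv_of_countable
  classical
  refine ⟨Equiv.subtypeCongr ((hf.mono hBA).bijOn_image.equiv f) e, ?_⟩
  refine Ultrafilter.coe_injective ?_
  rw [Ultrafilter.coe_map, Ultrafilter.coe_map]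
  refine Filter.map_congr (Filter.mem_of_superset hB fun x hx => ?_)
  have hx' : x ∈ B := hx
  simp [Equiv.subtypeCongr, Equiv.sumCompl_symm_apply_of_pos hx', Set.BijOn.equiv]

theorem UfIso.symm {S T : Type} {U : Ultrafilter S} {V : Ultrafilter T} (h : UfIso U V) :
    UfIso V U := by
  obtain ⟨f, rfl⟩ := h
  exact ⟨f.symm, by simp [Ultrafilter.map_map]⟩

theorem UfIso.trans {S T R : Type} {U : Ultrafilter S} {V : Ultrafilter T} {W : Ultrafilter R}
    (h : UfIso U V) (h' : UfIso V W) : UfIso U W := by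
  obtain ⟨f, rfl⟩ := h
  obtain ⟨g, rfl⟩ := h'
  exact ⟨f.trans g, by simp [Ultrafilter.map_map]⟩

theorem IsRamseyUf.isQPointUf {U : Ultrafilter ℕ} (hU : IsRamseyUf U) : IsQPointUf U := by
  refine ⟨hU.1, fun f hf => ?_⟩
  classical
  obtain ⟨A, hA, j, hj⟩ := hU.2 fun x y => if f x = f y then 0 else 1
  refine ⟨A, hA, ?_⟩
  by_cases h0 : j = 0
  · subst h0
    obtain ⟨a, ha⟩ := (hU.1 A hA).nonempty
    refine absurd ((hf (f a)).subset fun x hx => ?_) (hU.1 A hA)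
    rcases lt_trichotomy a x with h | h | h
    · simpa [eq_comm] using hj a ha x hx h
    · simp [h]
    · simpa using hj x hx a ha h
  · intro x hx y hy hxy
    by_contra hne
    rcases lt_or_gt_of_ne hne with h | h
    · exact h0 (by simpa [hxy] using (hj x hx y hy h).symm)
    · exact h0 (by simpa [hxy] using (hj y hy x hx h).symm)

/-- Finite-to-one images of non-isomorphic Q-points are separated by disjoint sets. -/
theorem IsQPointUf.exists_forall_ne {U V : Ultrafilter ℕ} (hU : IsQPointUf U)
    (hV : IsQPointUf V) (h : ¬ UfIso V U) {p q : ℕ → ℕ} (hp : ∀ m, (p ⁻¹' {m}).Finite)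
    (hq : ∀ m, (q ⁻¹' {m}).Finite) :
    ∃ Y ∈ U, ∃ v ∈ V, ∀ y ∈ Y, ∀ x ∈ v, p y ≠ q x := by
  obtain ⟨A, hA, hpA⟩ := hU.2 p hp
  obtain ⟨B, hB, hqB⟩ := hV.2 q hq
  have hne : U.map p ≠ V.map q := fun he =>
    h ((ufIso_map_of_injOn hV.1 hB hqB).trans (he ▸ (ufIso_map_of_injOn hU.1 hA hpA).symm))
  obtain ⟨s, hs, hs'⟩ : ∃ s, s ∈ U.map p ∧ s ∉ V.map q := by
    by_contra! hle
    exact hne (Ultrafilter.eq_of_le (f := V.map q) (g := U.map p) hle).symm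
  refine ⟨p ⁻¹' s, hs, (q ⁻¹' s)ᶜ, Ultrafilter.compl_mem_iff_notMem.2 hs', ?_⟩
  intro y hy x hx hyx
  exact hx (show q x ∈ s from hyx ▸ hy)

theorem StrictMono.exists_mem_Ico_succ {K : ℕ → ℕ} (hK : StrictMono K) (hK0 : K 0 = 0) (x : ℕ) :
    ∃ i, x ∈ Set.Ico (K i) (K (i + 1)) := by
  have hex : ∃ i, x < K (i + 1) := ⟨x, hK.le_apply⟩
  classical
  refine ⟨Nat.find hex, ?_, Nat.find_spec hex⟩
  rcases h : Nat.find hex with _ | m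
  · simp [hK0]
  · exact not_lt.1 (Nat.find_min hex (h ▸ m.lt_succ_self))

/-- A Q-point not isomorphic to any of finitely many pairwise non-isomorphic
Ramsey ultrafilters can be separated from them on any interval partition:
there are `Y_k ∈ U_k` and `v ∈ E` not meeting equal or adjacent intervals. -/
theorem qpoint_interval_separation (K : ℕ → ℕ) (hK : StrictMono K) (hK0 : K 0 = 0)
    (n : ℕ) (hn : 1 ≤ n) (U : Fin n → Ultrafilter ℕ)
    (hU : ∀ k, IsRamseyUf (U k))
    (hpair : ∀ k l : Fin n, k ≠ l → ¬ UfIso (U k) (U l))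
    (E : Ultrafilter ℕ) (hE : IsQPointUf E) (hEU : ∀ k, ¬ UfIso E (U k)) :
    ∃ Y : Fin n → Set ℕ, (∀ k, Y k ∈ U k) ∧
      ∃ v : Set ℕ, v ∈ E ∧
        ∀ i : ℕ, 2 ≤ i → ∀ k : Fin n,
          (Y k ∩ Set.Ico (K (i - 1)) (K i)).Nonempty →
            v ∩ Set.Ico (K (i - 2)) (K (i - 1)) = ∅ ∧
            v ∩ Set.Ico (K (i - 1)) (K i) = ∅ ∧
            v ∩ Set.Ico (K i) (K (i + 1)) = ∅ := by
  choose g hg using hK.exists_mem_Ico_succ hK0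
  have hguniq : ∀ {x i}, x ∈ Set.Ico (K i) (K (i + 1)) → g x = i := fun {x i} hx => by
    have h1 := hK.lt_iff_lt.1 (hx.1.trans_lt (hg x).2)
    have h2 := hK.lt_iff_lt.1 ((hg x).1.trans_lt hx.2)
    omega
  have hfin : ∀ m, (g ⁻¹' {m}).Finite := fun m =>
    (Set.finite_Iio (K (m + 1))).subset fun x hx => by
      have hx' : g x = m := hx
      exact hx' ▸ (hg x).2
  have hfin' : ∀ m, ((fun x => g x + 1) ⁻¹' {m}).Finite := fun m =>
    (hfin (m - 1)).subset fun x hx => by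
      have hx' : g x + 1 = m := hx
      change g x = m - 1
      omega
  have key : ∀ k, ∃ Y ∈ U k, ∃ v ∈ E, ∀ y ∈ Y, ∀ x ∈ v,
      g y ≠ g x ∧ g y + 1 ≠ g x ∧ g y ≠ g x + 1 := fun k => by
    have hQ := (hU k).isQPointUf
    obtain ⟨Y₁, hY₁, v₁, hv₁, h₁⟩ := hQ.exists_forall_ne hE (hEU k) hfin hfin
    obtain ⟨Y₂, hY₂, v₂, hv₂, h₂⟩ := hQ.exists_forall_ne hE (hEU k) hfin' hfin
    obtain ⟨Y₃, hY₃, v₃, hv₃, h₃⟩ := hQ.exists_forall_ne hE (hEU k) hfin hfin'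
    exact ⟨Y₁ ∩ (Y₂ ∩ Y₃), Filter.inter_mem hY₁ (Filter.inter_mem hY₂ hY₃),
      v₁ ∩ (v₂ ∩ v₃), Filter.inter_mem hv₁ (Filter.inter_mem hv₂ hv₃), fun y hy x hx =>
      ⟨h₁ y hy.1 x hx.1, h₂ y hy.2.1 x hx.2.1, h₃ y hy.2.2 x hx.2.2⟩⟩
  choose Y hY v hv hYv using key
  refine ⟨Y, hY, ⋂ k, v k, Filter.iInter_mem.2 hv, ?_⟩
  rintro i hi k ⟨y, hyY, hy⟩
  obtain ⟨j, rfl⟩ := Nat.exists_eq_add_of_le' hi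
  have hgy : g y = j + 1 := hguniq hy
  refine ⟨?_, ?_, ?_⟩ <;> refine Set.eq_empty_of_forall_notMem ?_ <;> rintro x ⟨hxv, hx⟩ <;>
    have hne := hYv k y hyY x (Set.mem_iInter.1 hxv k)
  · have hgx : g x = j := hguniq hx
    omega
  · have hgx : g x = j + 1 := hguniq hx
    omega
  · have hgx : g x = j + 2 := hguniq hx
    omega
end

section
/- (Shelah–Spinas) Let n ≥ 1 and let U_0,…,U_{n−1} be pairwise non-isomorphic Ramsey ultrafilters on ℕ. The Maiden has no winning strategy in the game G(⟨U_0,…,U_{n−1}⟩): for every function σ assigning to each finite sequence ⟨n_0,…,n_{i−1}⟩ of naturals a tuple ⟨X_0,…,X_{n−1}⟩ with X_k ∈ U_k for every k < n, there exists a sequence ⟨n_i : i ∈ ℕ⟩ such that for every i, n_i is an element of the (i mod n)-th component of σ(⟨n_0,…,n_{i−1}⟩), and for every k < n the set {n_i : i ≡ k (mod n)} belongs to U_k. -/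
theorem FreeUf.finite_compl_mem {U : Ultrafilter ℕ} (hU : FreeUf U) {A : Set ℕ}
    (hA : Aᶜ.Finite) : A ∈ U := by
  by_contra h
  exact hU _ (Ultrafilter.compl_mem_iff_notMem.mpr h) hA

theorem IsRamseyUf.exists_diagonal {U : Ultrafilter ℕ} (hU : IsRamseyUf U)
    (D : ℕ → Set ℕ) (hD : ∀ a, D a ∈ U) :
    ∃ A ∈ U, ∀ a ∈ A, ∀ b ∈ A, a < b → b ∈ D a := by
  classical
  obtain ⟨A, hA, j, hj⟩ := hU.2 fun a b => if b ∈ D a then 1 else 0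
  refine ⟨A, hA, fun a ha b hb hab => ?_⟩
  have hj1 : j = 1 := by
    obtain ⟨c, hc, hac⟩ := (hU.1 _ (Filter.inter_mem hA (hD a))).exists_gt a
    rw [← hj a ha c hc.1 hac, if_pos hc.2]
  have h := hj a ha b hb hab
  by_contra hn
  simp [hj1, hn] at h

theorem IsRamseyUf.exists_injOn {U : Ultrafilter ℕ} (hU : IsRamseyUf U) (f : ℕ → ℕ)
    (hf : ∀ m, (f ⁻¹' {m}).Finite) : ∃ A ∈ U, Set.InjOn f A := by
  obtain ⟨A, hA, h⟩ := hU.exists_diagonal (fun a => {b | f b ≠ f a}) fun a =>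
    hU.1.finite_compl_mem ((hf (f a)).subset fun b hb => by simpa using hb)
  refine ⟨A, hA, fun a ha b hb hab => ?_⟩
  rcases lt_trichotomy a b with hlt | heq | hlt
  · exact absurd hab.symm (h a ha b hb hlt)
  · exact heq
  · exact absurd hab (h b hb a ha hlt)

theorem exists_equiv_eqOn_of_injOn {A : Set ℕ} {f : ℕ → ℕ} (hf : Set.InjOn f A)
    (hA : Aᶜ.Infinite) (hfA : (f '' A)ᶜ.Infinite) : ∃ e : ℕ ≃ ℕ, Set.EqOn e f A := by
  classical
  have : Infinite {x // x ∉ A} := hA.to_subtype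
  have : Infinite {x // x ∉ f '' A} := hfA.to_subtype
  obtain ⟨e₂⟩ := nonempty_equiv_of_countable (α := {x // x ∉ A}) (β := {x // x ∉ f '' A})
  let e₁ : {x // x ∈ A} ≃ {x // x ∈ f '' A} := Equiv.Set.imageOfInjOn f A hf
  refine ⟨Equiv.subtypeCongr e₁ e₂, fun a ha => ?_⟩
  simp [Equiv.subtypeCongr, Equiv.sumCompl, ha, e₁, Equiv.Set.imageOfInjOn]

theorem FreeUf.exists_infinite_compl_subset {U : Ultrafilter ℕ} (hU : FreeUf U) {A : Set ℕ}
    (hA : A ∈ U) : ∃ B ∈ U, B ⊆ A ∧ (A \ B).Infinite := by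
  have hinf := hU A hA
  have : Infinite A := hinf.to_subtype
  let g := Nat.Subtype.orderIsoOfNat A
  let P : Set ℕ := Set.range fun i => (g (2 * i) : ℕ)
  have hP : P.Infinite := Set.infinite_range_of_injective fun i j h => by
    have := g.injective (Subtype.ext h)
    omega
  have hQ : (Set.range fun i => (g (2 * i + 1) : ℕ)).Infinite :=
    Set.infinite_range_of_injective fun i j h => by
      have := g.injective (Subtype.ext h)
      omega
  have hPA : P ⊆ A := by
    rintro _ ⟨i, rfl⟩
    exact (g (2 * i)).2
  rcases Ultrafilter.mem_or_compl_mem U P with h | h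
  · refine ⟨P, h, hPA, hQ.mono ?_⟩
    rintro _ ⟨i, rfl⟩
    refine ⟨(g (2 * i + 1)).2, ?_⟩
    rintro ⟨j, hj⟩
    have := g.injective (Subtype.ext hj)
    omega
  · refine ⟨A ∩ Pᶜ, Filter.inter_mem hA h, Set.inter_subset_left, hP.mono fun x hx => ?_⟩
    exact ⟨hPA hx, fun h' => h'.2 hx⟩

theorem FreeUf.exists_equiv_map_eq {U : Ultrafilter ℕ} (hU : FreeUf U) {A : Set ℕ}
    (hA : A ∈ U) {f : ℕ → ℕ} (hf : Set.InjOn f A) :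
    ∃ e : ℕ ≃ ℕ, Ultrafilter.map e U = Ultrafilter.map f U := by
  obtain ⟨B, hB, hBA, hinf⟩ := hU.exists_infinite_compl_subset hA
  obtain ⟨e, he⟩ := exists_equiv_eqOn_of_injOn (hf.mono hBA) (hinf.mono fun x hx => hx.2)
    ((hinf.image (hf.mono Set.sdiff_subset)).mono (by
      rintro _ ⟨x, hx, rfl⟩ ⟨y, hy, hxy⟩
      exact hx.2 (hf (hBA hy) hx.1 hxy ▸ hy)))
  refine ⟨e, Ultrafilter.coe_injective ?_⟩
  rw [Ultrafilter.coe_map, Ultrafilter.coe_map]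
  exact Filter.map_congr (Filter.eventuallyEq_of_mem hB he)

theorem IsRamseyUf.exists_separating_set {U V : Ultrafilter ℕ} (hU : IsRamseyUf U)
    (hV : IsRamseyUf V) (hUV : ¬ UfIso U V) (f : ℕ → ℕ) (hf : ∀ m, (f ⁻¹' {m}).Finite) :
    ∃ E : Set ℕ, f ⁻¹' E ∈ U ∧ f ⁻¹' Eᶜ ∈ V := by
  by_contra! h
  have hle : (Ultrafilter.map f V : Filter ℕ) ≤ Ultrafilter.map f U := fun E hE => by
    have := h E (Ultrafilter.mem_map.mp hE)
    rw [Set.preimage_compl, Ultrafilter.compl_mem_iff_notMem, not_not] at this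
    exact this
  have heq : Ultrafilter.map f V = Ultrafilter.map f U := Ultrafilter.coe_le_coe.mp hle
  obtain ⟨A, hA, hfA⟩ := hU.exists_injOn f hf
  obtain ⟨B, hB, hfB⟩ := hV.exists_injOn f hf
  obtain ⟨e, he⟩ := hU.1.exists_equiv_map_eq hA hfA
  obtain ⟨e', he'⟩ := hV.1.exists_equiv_map_eq hB hfB
  refine hUV ⟨e.trans e'.symm, ?_⟩
  rw [Equiv.coe_trans, ← Ultrafilter.map_map, he, ← heq, ← he', Ultrafilter.map_map]
  simp [Ultrafilter.map_id]

theorem exists_block_index {g : ℕ → ℕ} (hg : StrictMono g) (h0 : g 0 = 0) :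
    ∃ f : ℕ → ℕ, ∀ a, g (f a) ≤ a ∧ a < g (f a + 1) := by
  refine ⟨fun a => Nat.findGreatest (fun j => g j ≤ a) a, fun a => ⟨?_, ?_⟩⟩
  · exact Nat.findGreatest_spec (P := fun j => g j ≤ a) (Nat.zero_le a) (by simp [h0])
  · by_contra! h
    have := Nat.le_findGreatest (P := fun j => g j ≤ a) ((hg.le_apply).trans h) h
    omega

theorem IsRamseyUf.exists_cross_separated {U V : Ultrafilter ℕ} (hU : IsRamseyUf U)
    (hV : IsRamseyUf V) (hUV : ¬ UfIso U V) {G : ℕ → ℕ} (hG : Monotone G)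
    (hlt : ∀ a, a < G a) :
    ∃ A ∈ U, ∃ B ∈ V, ∀ a ∈ A, ∀ b ∈ B, G a ≤ b ∨ G b ≤ a := by
  let g : ℕ → ℕ := fun j => G^[j] 0
  have hgs : ∀ j, g (j + 1) = G (g j) := fun j => Function.iterate_succ_apply' G j 0
  have hg : StrictMono g := strictMono_nat_of_lt_succ fun j => by rw [hgs]; exact hlt _
  obtain ⟨f, hf⟩ := exists_block_index hg rfl
  have hfin : ∀ φ : ℕ → ℕ, (∀ a, f a ≤ 2 * φ a + 1) → ∀ m, (φ ⁻¹' {m}).Finite := by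
    intro φ hφ m
    refine (Set.finite_Iio (g (2 * m + 2))).subset fun a ha => ?_
    have h1 : φ a = m := ha
    have h2 := hφ a
    exact (hf a).2.trans_le (hg.monotone (by omega))
  obtain ⟨E, hE, hE'⟩ := hU.exists_separating_set hV hUV (fun a => f a / 2)
    (hfin _ fun a => by omega)
  obtain ⟨F, hF, hF'⟩ := hU.exists_separating_set hV hUV (fun a => (f a + 1) / 2)
    (hfin _ fun a => by omega)
  have key : ∀ a b, f a + 2 ≤ f b → G a ≤ b := fun a b hab =>
    calc G a ≤ G (g (f a + 1)) := hG (hf a).2.le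
      _ = g (f a + 2) := (hgs _).symm
      _ ≤ g (f b) := hg.monotone hab
      _ ≤ b := (hf b).1
  refine ⟨_, Filter.inter_mem hE hF, _, Filter.inter_mem hE' hF', ?_⟩
  rintro a ⟨ha1, ha2⟩ b ⟨hb1, hb2⟩
  have h1 : f a / 2 ≠ f b / 2 := fun h => hb1 (by simpa [← h] using ha1)
  have h2 : (f a + 1) / 2 ≠ (f b + 1) / 2 := fun h => hb2 (by simpa [← h] using ha2)
  rcases le_total (f a) (f b) with h | h
  · exact Or.inl (key a b (by omega))
  · exact Or.inr (key b a (by omega))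

theorem IsRamseyUf.exists_self_separated {U : Ultrafilter ℕ} (hU : IsRamseyUf U)
    (G : ℕ → ℕ) : ∃ A ∈ U, ∀ a ∈ A, ∀ b ∈ A, a ≠ b → G a ≤ b ∨ G b ≤ a := by
  obtain ⟨A, hA, h⟩ := hU.exists_diagonal (fun a => {b | G a ≤ b}) fun a =>
    hU.1.finite_compl_mem ((Set.finite_Iio (G a)).subset fun b hb => by simpa using hb)
  refine ⟨A, hA, fun a ha b hb hab => ?_⟩
  rcases lt_or_gt_of_ne hab with hlt | hlt
  · exact Or.inl (h a ha b hb hlt)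
  · exact Or.inr (h b hb a ha hlt)

theorem exists_jointly_separated {ι : Type} [Finite ι] {U : ι → Ultrafilter ℕ}
    (hU : ∀ k, IsRamseyUf (U k)) (hpair : ∀ k l, k ≠ l → ¬ UfIso (U k) (U l))
    {G : ℕ → ℕ} (hG : Monotone G) (hlt : ∀ a, a < G a) :
    ∃ B : ι → Set ℕ, (∀ k, B k ∈ U k) ∧
      ∀ k l, ∀ a ∈ B k, ∀ b ∈ B l, (k ≠ l ∨ a ≠ b) → G a ≤ b ∨ G b ≤ a := by
  have h : ∀ k l, ∃ A ∈ U k, ∃ B ∈ U l,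
      ∀ a ∈ A, ∀ b ∈ B, (k ≠ l ∨ a ≠ b) → G a ≤ b ∨ G b ≤ a := by
    intro k l
    by_cases hkl : k = l
    · subst hkl
      obtain ⟨A, hA, h⟩ := (hU k).exists_self_separated G
      exact ⟨A, hA, A, hA, fun a ha b hb hab => h a ha b hb (by simpa using hab)⟩
    · obtain ⟨A, hA, B, hB, h⟩ :=
        (hU k).exists_cross_separated (hU l) (hpair k l hkl) hG hlt
      exact ⟨A, hA, B, hB, fun a ha b hb _ => h a ha b hb⟩
  choose P hP Q hQ hPQ using h
  refine ⟨fun k => ⋂ l, P k l ∩ Q l k, fun k => ?_, fun k l a ha b hb => ?_⟩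
  · exact Filter.iInter_mem.mpr fun l => Filter.inter_mem (hP k l) (hQ l k)
  · exact hPQ k l a (Set.mem_iInter.mp ha l).1 b (Set.mem_iInter.mp hb k).2

/-- The game in which Death chooses at each stage both a coordinate and an element of the
Maiden's set in that coordinate: Death can arrange that the elements chosen in each coordinate
form a set in the corresponding ultrafilter. -/
theorem exists_run_of_free_game {ι S : Type} [Finite ι] {U : ι → Ultrafilter ℕ}
    (hU : ∀ k, IsRamseyUf (U k)) (hpair : ∀ k l, k ≠ l → ¬ UfIso (U k) (U l))
    (s₀ : S) (T : S → ι → Set ℕ) (hT : ∀ s k, T s k ∈ U k) (next : S → ι → ℕ → S) :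
    ∃ (B : ι → Set ℕ) (st : ℕ → S), (∀ k, B k ∈ U k) ∧ st 0 = s₀ ∧
      (∀ m k, m ∈ B k → m ∈ T (st m) k ∧ st (m + 1) = next (st m) k m) ∧
      ∀ m, (∀ k, m ∉ B k) → st (m + 1) = st m := by
  classical
  let L : ℕ → Set S := fun m =>
    Nat.rec {s₀} (fun m X => X ∪ ⋃ k, (fun s => next s k m) '' X) m
  have hLs : ∀ m, L (m + 1) = L m ∪ ⋃ k, (fun s => next s k m) '' L m := fun _ => rfl
  have hLfin : ∀ m, (L m).Finite := by
    intro m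
    induction m with
    | zero => exact Set.finite_singleton s₀
    | succ m ih =>
      rw [hLs]
      exact ih.union (Set.finite_iUnion fun k => ih.image _)
  have hLmono : Monotone L := monotone_nat_of_le_succ fun m => by
    rw [hLs]; exact Set.subset_union_left
  have hs₀ : ∀ m, s₀ ∈ L m := fun m => hLmono (Nat.zero_le m) (Set.mem_singleton s₀)
  let D : ι → ℕ → Set ℕ := fun k m => ⋂ s ∈ L (m + 1), T s k
  have hD : ∀ k m, D k m ∈ U k := fun k m =>
    (Filter.biInter_mem (f := (U k : Filter ℕ)) (hLfin (m + 1))).mpr fun s _ => hT s k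
  have hDanti : ∀ k, Antitone (D k) := fun k a b hab =>
    Set.biInter_subset_biInter_left (hLmono (Nat.succ_le_succ hab))
  choose C hC hCD using fun k => (hU k).exists_diagonal (D k) (hD k)
  choose c hcC hc using fun k m => ((hU k).1 (C k) (hC k)).exists_gt m
  cases nonempty_fintype ι
  let G : ℕ → ℕ := fun m => m + 1 + ∑ a ∈ Finset.range (m + 1), ∑ k, (c k a + 1)
  have hG : Monotone G := fun a b hab => by
    have : ∑ a ∈ Finset.range (a + 1), ∑ k, (c k a + 1) ≤
        ∑ a ∈ Finset.range (b + 1), ∑ k, (c k a + 1) :=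
      Finset.sum_le_sum_of_subset (Finset.range_subset_range.mpr (by omega))
    simp only [G]
    omega
  have hlt : ∀ a, a < G a := fun a => by simp only [G]; omega
  have hcG : ∀ k a, c k a < G a := fun k a => by
    have h1 : c k a + 1 ≤ ∑ k, (c k a + 1) :=
      Finset.single_le_sum (f := fun k => c k a + 1) (fun _ _ => Nat.zero_le _)
        (Finset.mem_univ k)
    have h2 : ∑ k, (c k a + 1) ≤ ∑ a ∈ Finset.range (a + 1), ∑ k, (c k a + 1) :=
      Finset.single_le_sum (f := fun a => ∑ k, (c k a + 1)) (fun _ _ => Nat.zero_le _)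
        (Finset.self_mem_range_succ a)
    simp only [G]
    omega
  obtain ⟨B, hB, hsep⟩ := exists_jointly_separated hU hpair hG hlt
  let B' : ι → Set ℕ := fun k => B k ∩ (C k ∩ T s₀ k)
  have huniq : ∀ m k l, m ∈ B' k → m ∈ B' l → k = l := by
    intro m k l hk hl
    by_contra hkl
    have := hsep k l m hk.1 m hl.1 (Or.inl hkl)
    have := hlt m
    omega
  let st : ℕ → S := fun m => Nat.rec s₀
    (fun m s => if h : ∃ k, m ∈ B' k then next s h.choose m else s) m
  have hst : ∀ m, st (m + 1) =
      if h : ∃ k, m ∈ B' k then next (st m) h.choose m else st m := fun _ => rfl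
  have hst1 : ∀ m k, m ∈ B' k → st (m + 1) = next (st m) k m := by
    intro m k hk
    have h : ∃ k, m ∈ B' k := ⟨k, hk⟩
    rw [hst, dif_pos h, huniq m _ k h.choose_spec hk]
  have hst2 : ∀ m, (∀ k, m ∉ B' k) → st (m + 1) = st m := fun m h => by
    rw [hst, dif_neg (by simpa using h)]
  have hstL : ∀ m, st m ∈ L m := by
    intro m
    induction m with
    | zero => exact hs₀ 0
    | succ m ih =>
      by_cases h : ∃ k, m ∈ B' k
      · obtain ⟨k, hk⟩ := h
        rw [hst1 m k hk, hLs]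
        exact Or.inr (Set.mem_iUnion.mpr ⟨k, _, ih, rfl⟩)
      · rw [hst2 m (by simpa using h)]
        exact hLmono (Nat.le_succ m) ih
  have hlast : ∀ m, st m = s₀ ∨ ∃ a < m, (∃ k, a ∈ B' k) ∧ st m ∈ L (a + 1) := by
    intro m
    induction m with
    | zero => exact Or.inl rfl
    | succ m ih =>
      by_cases h : ∃ k, m ∈ B' k
      · exact Or.inr ⟨m, Nat.lt_succ_self m, h, hstL (m + 1)⟩
      · rw [hst2 m (by simpa using h)]
        exact ih.imp_right fun ⟨a, ha, h⟩ => ⟨a, by omega, h⟩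
  refine ⟨B', st, fun k => ?_, rfl, fun m k hk => ⟨?_, hst1 m k hk⟩, hst2⟩
  · exact Filter.inter_mem (hB k) (Filter.inter_mem (hC k) (hT s₀ k))
  · rcases hlast m with h | ⟨a, ham, ⟨l, hl⟩, h⟩
    · rw [h]; exact hk.2.2
    · have h1 : G a ≤ m := by
        have := hsep l k a hl.1 m hk.1 (Or.inr ham.ne)
        have := hlt m
        omega
      have h2 : m ∈ D k (c k a) :=
        hCD k _ (hcC k a) m hk.2.1 ((hcG k a).trans_le h1)
      exact Set.mem_iInter₂.mp (hDanti k (hc k a).le h2) _ h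

/-- A finite run of the game in which every response of Death obeys the rules. -/
def IsLegalRun {n : ℕ} (hn : 0 < n) (σ : List ℕ → Fin n → Set ℕ) (s : List ℕ) : Prop :=
  ∀ i (h : i < s.length), s[i] ∈ σ (s.take i) ⟨i % n, Nat.mod_lt i hn⟩

theorem IsLegalRun.concat {n : ℕ} {hn : 0 < n} {σ : List ℕ → Fin n → Set ℕ} {s : List ℕ}
    (hs : IsLegalRun hn σ s) {b : ℕ} (hb : b ∈ σ s ⟨s.length % n, Nat.mod_lt _ hn⟩) :
    IsLegalRun hn σ (s ++ [b]) := by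
  intro i hi
  rcases Nat.lt_or_ge i s.length with h | h
  · rw [List.getElem_append_left h, List.take_append_of_le_length h.le]
    exact hs i h
  · obtain rfl : i = s.length := by
      simp only [List.length_append, List.length_singleton] at hi
      omega
    simpa using hb

theorem exists_legal_extension {n : ℕ} (hn : 0 < n) {σ : List ℕ → Fin n → Set ℕ}
    (hσ : ∀ l k, (σ l k).Nonempty) (s : List ℕ) (d : ℕ) :
    ∃ t, s <+: t ∧ t.length = s.length + d ∧ (IsLegalRun hn σ s → IsLegalRun hn σ t) := by
  induction d with
  | zero => exact ⟨s, List.prefix_rfl, rfl, id⟩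
  | succ d ih =>
    obtain ⟨t, hst, hlen, ht⟩ := ih
    obtain ⟨b, hb⟩ := hσ t ⟨t.length % n, Nat.mod_lt _ hn⟩
    refine ⟨t ++ [b], hst.trans (List.prefix_append _ _), ?_, fun hs => (ht hs).concat hb⟩
    simp [hlen, Nat.add_assoc]

theorem exists_legal_extension_to_turn {n : ℕ} (hn : 0 < n) {σ : List ℕ → Fin n → Set ℕ}
    (hσ : ∀ l k, (σ l k).Nonempty) (s : List ℕ) (k : Fin n) :
    ∃ t, s <+: t ∧ t.length % n = k ∧ (IsLegalRun hn σ s → IsLegalRun hn σ t) := by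
  obtain ⟨t, hst, hlen, ht⟩ :=
    exists_legal_extension hn hσ s (n * s.length - s.length + k)
  refine ⟨t, hst, ?_, ht⟩
  have : s.length ≤ n * s.length := Nat.le_mul_of_pos_left _ hn
  rw [hlen, ← Nat.add_assoc, Nat.add_sub_cancel' this, Nat.mul_add_mod,
    Nat.mod_eq_of_lt k.2]

theorem exists_seq_getElem_eq {α : Type} (l : ℕ → List α)
    (hl : ∀ m, l m <+: l (m + 1)) (hlen : ∀ i, ∃ m, i < (l m).length) :
    ∃ e : ℕ → α, ∀ m i (h : i < (l m).length), (l m)[i] = e i := by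
  have hmono : ∀ a b, a ≤ b → l a <+: l b := fun a b hab =>
    Nat.le_induction List.prefix_rfl (fun m _ ih => ih.trans (hl m)) b hab
  choose N hN using hlen
  refine ⟨fun i => (l (N i))[i]'(hN i), fun m i h => ?_⟩
  rw [(hmono m (max m (N i)) (le_max_left _ _)).getElem h,
    ← (hmono (N i) (max m (N i)) (le_max_right _ _)).getElem (hN i)]

/-- Shelah–Spinas: the Maiden has no winning strategy in the game
`G(⟨U_0,…,U_{n−1}⟩)` for pairwise non-isomorphic Ramsey ultrafilters. -/
theorem maiden_no_winning_strategy (n : ℕ) (hn : 0 < n)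
    (U : Fin n → Ultrafilter ℕ) (hU : ∀ k, IsRamseyUf (U k))
    (hpair : ∀ k l : Fin n, k ≠ l → ¬ UfIso (U k) (U l))
    (σ : List ℕ → Fin n → Set ℕ) (hσ : ∀ l k, σ l k ∈ U k) :
    ∃ e : ℕ → ℕ,
      (∀ i : ℕ, e i ∈ σ (List.ofFn fun j : Fin i => e j) ⟨i % n, Nat.mod_lt i hn⟩) ∧
      ∀ k : Fin n, {m : ℕ | ∃ i : ℕ, i % n = (k : ℕ) ∧ e i = m} ∈ U k := by
  choose t hpre hturn hlegal using
    exists_legal_extension_to_turn hn fun l k => Ultrafilter.nonempty_of_mem (hσ l k)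
  obtain ⟨B, st, hB, h0, hmem, hskip⟩ := exists_run_of_free_game hU hpair []
    (fun s k => σ (t s k) k) (fun s k => hσ _ k) (fun s k b => t s k ++ [b])
  have hst : ∀ m, IsLegalRun hn σ (st m) := by
    intro m
    induction m with
    | zero => rw [h0]; intro i hi; simp at hi
    | succ m ih =>
      by_cases h : ∃ k, m ∈ B k
      · obtain ⟨k, hk⟩ := h
        rw [(hmem m k hk).2]
        refine (hlegal _ k ih).concat ?_
        have : (⟨(t (st m) k).length % n, Nat.mod_lt _ hn⟩ : Fin n) = k :=
          Fin.ext (hturn _ k)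
        rw [this]
        exact (hmem m k hk).1
      · rw [hskip m (by simpa using h)]
        exact ih
  have hchain : ∀ m, st m <+: st (m + 1) := by
    intro m
    by_cases h : ∃ k, m ∈ B k
    · obtain ⟨k, hk⟩ := h
      rw [(hmem m k hk).2]
      exact (hpre _ k).trans (List.prefix_append _ _)
    · rw [hskip m (by simpa using h)]
  have hlen : ∀ i, ∃ m, i < (st m).length := by
    intro i
    induction i with
    | zero =>
      obtain ⟨b, hb⟩ := Ultrafilter.nonempty_of_mem (hB ⟨0, hn⟩)
      exact ⟨b + 1, by rw [(hmem b _ hb).2]; simp⟩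
    | succ i ih =>
      obtain ⟨m, hm⟩ := ih
      obtain ⟨b, hb, hmb⟩ := ((hU _).1 _ (hB ⟨0, hn⟩)).exists_gt m
      have h1 : (st m).length ≤ (st b).length :=
        Nat.le_induction le_rfl (fun j _ ih => ih.trans (hchain j).length_le) b hmb.le
      have h2 := (hpre (st b) ⟨0, hn⟩).length_le
      refine ⟨b + 1, ?_⟩
      rw [(hmem b _ hb).2, List.length_append, List.length_singleton]
      omega
  obtain ⟨e, he⟩ := exists_seq_getElem_eq st hchain hlen
  refine ⟨e, fun i => ?_, fun k => Filter.mem_of_superset (hB k) fun b hb => ?_⟩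
  · obtain ⟨m, hm⟩ := hlen i
    have h := hst m i hm
    have htake : (st m).take i = List.ofFn fun j : Fin i => e j := by
      refine List.ext_getElem (by simp [hm.le]) fun j hj _ => ?_
      rw [List.getElem_take, List.getElem_ofFn, he]
    rwa [htake, he] at h
  · refine ⟨(t (st b) k).length, hturn _ k, ?_⟩
    have heq := (hmem b k hb).2
    rw [← he (b + 1) _ (by rw [heq]; simp)]
    simp [heq]
end

section
/- Two Q-points on ℕ are nearly coherent if and only if they are isomorphic. -/
/-- `f` is finite-to-one if all its fibers are finite. -/
def FiniteToOne (f : ℕ → ℕ) : Prop := ∀ m, (f ⁻¹' {m}).Finite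

/-- Two ultrafilters are nearly coherent if some finite-to-one map identifies
their images. -/
def NearlyCoherent (U V : Ultrafilter ℕ) : Prop :=
  ∃ f : ℕ → ℕ, FiniteToOne f ∧ Ultrafilter.map f U = Ultrafilter.map f V

theorem Ultrafilter.exists_mem_infinite_compl (U : Ultrafilter ℕ) :
    ∃ D ∈ U, (Dᶜ : Set ℕ).Infinite := by
  rcases U.mem_or_compl_mem {n | Even n} with h | h
  · refine ⟨_, h, Set.infinite_of_forall_exists_gt fun n => ⟨2 * n + 1, ?_, by omega⟩⟩
    simp
  · refine ⟨_, h, Set.infinite_of_forall_exists_gt fun n => ⟨2 * n + 2, ?_, by omega⟩⟩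
    simp [Nat.even_add]

/-- A bijection between two sets of naturals with infinite complements, given by matching values
of a map that is injective on both, extends to a permutation. -/
theorem exists_perm_of_image_eq {f : ℕ → ℕ} {P Q : Set ℕ} (hP : Set.InjOn f P)
    (hQ : Set.InjOn f Q) (hPQ : f '' P = f '' Q) (hPc : (Pᶜ).Infinite) (hQc : (Qᶜ).Infinite) :
    ∃ g : ℕ ≃ ℕ, ∀ x ∈ P, g x ∈ Q ∧ f (g x) = f x := by
  classical
  have := hPc.to_subtype
  have := hQc.to_subtype
  obtain ⟨e'⟩ : Nonempty ((Pᶜ : Set ℕ) ≃ (Qᶜ : Set ℕ)) := nonempty_equiv_of_countable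
  let eP : P ≃ f '' P := hP.bijOn_image.equiv f
  let eQ : Q ≃ f '' Q := hQ.bijOn_image.equiv f
  let e : P ≃ Q := eP.trans ((Equiv.setCongr hPQ).trans eQ.symm)
  refine ⟨(Equiv.Set.sumCompl P).symm.trans
    ((Equiv.sumCongr e e').trans (Equiv.Set.sumCompl Q)), fun x hx => ?_⟩
  have hfe : f (e ⟨x, hx⟩) = f x :=
    congrArg Subtype.val (eQ.apply_symm_apply (Equiv.setCongr hPQ (eP ⟨x, hx⟩)))
  simp [Equiv.Set.sumCompl_symm_apply_of_mem hx, hfe]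

/-- If a single map has the same image of `U` and `V` and is injective on a member of each,
then `U` and `V` are isomorphic. -/
theorem UfIso.of_injOn {U V : Ultrafilter ℕ} {f : ℕ → ℕ}
    (hf : Ultrafilter.map f U = Ultrafilter.map f V) {A B : Set ℕ} (hA : A ∈ U) (hB : B ∈ V)
    (hfA : Set.InjOn f A) (hfB : Set.InjOn f B) : UfIso U V := by
  obtain ⟨D, hD, hDc⟩ := U.exists_mem_infinite_compl
  obtain ⟨E, hE, hEc⟩ := V.exists_mem_infinite_compl
  have hmem (S : Set ℕ) : f ⁻¹' S ∈ U ↔ f ⁻¹' S ∈ V := by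
    rw [← Ultrafilter.mem_map, hf, Ultrafilter.mem_map]
  have hAD : f ⁻¹' (f '' (A ∩ D)) ∈ V := (hmem _).1 <|
    Filter.mem_of_superset (Filter.inter_mem hA hD) (Set.subset_preimage_image f _)
  have hBE : f ⁻¹' (f '' (B ∩ E)) ∈ U := (hmem _).2 <|
    Filter.mem_of_superset (Filter.inter_mem hB hE) (Set.subset_preimage_image f _)
  let P := (A ∩ D) ∩ f ⁻¹' (f '' (B ∩ E))
  let Q := (B ∩ E) ∩ f ⁻¹' (f '' (A ∩ D))
  have hPU : P ∈ U := Filter.inter_mem (Filter.inter_mem hA hD) hBE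
  have hQV : Q ∈ V := Filter.inter_mem (Filter.inter_mem hB hE) hAD
  have hfQ : Set.InjOn f Q := hfB.mono fun x hx => hx.1.1
  obtain ⟨g, hg⟩ := exists_perm_of_image_eq (f := f) (P := P) (Q := Q)
    (hfA.mono fun x hx => hx.1.1) hfQ
    (by simp only [P, Q, Set.image_inter_preimage, Set.inter_comm])
    (hDc.mono (Set.compl_subset_compl.2 fun x hx => hx.1.2))
    (hEc.mono (Set.compl_subset_compl.2 fun x hx => hx.1.2))
  refine ⟨g, Ultrafilter.eq_of_le fun S hS => ?_⟩
  have hSQ : f ⁻¹' (f '' (S ∩ Q)) ∈ U := (hmem _).2 <|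
    Filter.mem_of_superset (Filter.inter_mem hS hQV) (Set.subset_preimage_image f _)
  refine Filter.mem_map.2 (Filter.mem_of_superset (Filter.inter_mem hSQ hPU) ?_)
  rintro x ⟨⟨s, ⟨hsS, hsQ⟩, hs⟩, hxP⟩
  obtain ⟨hgQ, hfg⟩ := hg x hxP
  have : g x = s := hfQ hgQ hsQ (hfg.trans hs.symm)
  exact Set.mem_preimage.2 (this ▸ hsS)

/-- Every permutation of `ℕ` moves some finite-to-one rank function by at most one. -/
theorem exists_finiteToOne_rank (g : ℕ ≃ ℕ) :
    ∃ h : ℕ → ℕ, FiniteToOne h ∧ ∀ n, h (g n) ≤ h n + 1 ∧ h n ≤ h (g n) + 1 := by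
  let b : ℕ → ℕ := fun n => ∑ i ∈ Finset.range (n + 1), (g i + g.symm i + 1)
  have hb : Monotone b := fun m n hmn =>
    Finset.sum_le_sum_of_subset (Finset.range_mono (by omega))
  have hgb (n) : g n + g.symm n + 1 ≤ b n :=
    Finset.single_le_sum (f := fun i => g i + g.symm i + 1) (fun _ _ => Nat.zero_le _)
      (Finset.self_mem_range_succ n)
  have hlt (n) : n < b n := by
    have : ∑ i ∈ Finset.range (n + 1), 1 ≤ b n := Finset.sum_le_sum fun i _ => by omega
    simp at this
    omega
  let a : ℕ → ℕ := fun k => b^[k] 0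
  have hsucc (k) : a (k + 1) = b (a k) := Function.iterate_succ_apply' b k 0
  have ha : ∀ n, ∃ k, n ≤ a k := fun n =>
    ⟨n, (strictMono_nat_of_lt_succ fun k => hsucc k ▸ hlt _).le_apply⟩
  refine ⟨fun n => Nat.find (ha n), fun m => (Set.finite_Iic (a m)).subset ?_, fun n => ⟨?_, ?_⟩⟩
  · rintro n rfl
    exact Nat.find_spec (ha n)
  · refine Nat.find_min' _ ?_
    rw [hsucc]
    beta_reduce
    have := hb (Nat.find_spec (ha n))
    have := hgb n
    omega
  · refine Nat.find_min' _ ?_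
    rw [hsucc]
    beta_reduce
    have := hb (Nat.find_spec (ha (g n)))
    have := hgb (g n)
    rw [g.symm_apply_apply] at this
    omega

theorem NearlyCoherent.of_eventually_eq {U : Ultrafilter ℕ} {f g : ℕ → ℕ} (hf : FiniteToOne f)
    (h : {n | f (g n) = f n} ∈ U) : NearlyCoherent U (Ultrafilter.map g U) := by
  refine ⟨f, hf, Ultrafilter.coe_injective ?_⟩
  rw [Ultrafilter.map_map, Ultrafilter.coe_map, Ultrafilter.coe_map]
  exact Filter.map_congr (Filter.mem_of_superset h fun n hn => Eq.symm hn)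

/-- Isomorphic ultrafilters on `ℕ` are nearly coherent. -/
theorem UfIso.nearlyCoherent {U V : Ultrafilter ℕ} (hUV : UfIso U V) : NearlyCoherent U V := by
  obtain ⟨g, rfl⟩ := hUV
  obtain ⟨h, hfin, hh⟩ := exists_finiteToOne_rank g
  have hfin' (c : ℕ) : FiniteToOne fun n => (h n + c) / 2 := fun m => by
    refine ((Set.finite_Iic (2 * m + 1)).preimage' fun k _ => hfin k).subset fun n hn => ?_
    simp only [Set.mem_preimage, Set.mem_singleton_iff, Set.mem_Iic] at hn ⊢
    omega
  rcases U.mem_or_compl_mem {n | (h (g n) + 0) / 2 = (h n + 0) / 2} with hU | hU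
  · exact .of_eventually_eq (hfin' 0) hU
  · refine .of_eventually_eq (hfin' 1) (Filter.mem_of_superset hU fun n hn => ?_)
    have := hh n
    simp only [Set.mem_compl_iff, Set.mem_ofPred_eq] at hn ⊢
    omega

/-- Two Q-points are nearly coherent iff they are isomorphic. -/
theorem qpoints_nearlyCoherent_iff_iso (U V : Ultrafilter ℕ)
    (hU : IsQPointUf U) (hV : IsQPointUf V) :
    NearlyCoherent U V ↔ UfIso U V := by
  refine ⟨?_, UfIso.nearlyCoherent⟩
  rintro ⟨f, hfin, hf⟩
  obtain ⟨A, hA, hfA⟩ := hU.2 f hfin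
  obtain ⟨B, hB, hfB⟩ := hV.2 f hfin
  exact .of_injOn hf hA hB hfA hfB
end

section
/- (Blass) Near coherence is an equivalence relation on the set of free ultrafilters on ℕ: it is reflexive, symmetric, and transitive (in particular, if U and V are nearly coherent and V and W are nearly coherent, where U, V, W are free ultrafilters on ℕ, then U and W are nearly coherent). -/
/-- If `f` identifies two ultrafilters, then the `f`-saturation of a member of the first belongs
to the second. -/
theorem saturation_mem_of_map_eq {U V : Ultrafilter ℕ} {f : ℕ → ℕ}
    (h : Ultrafilter.map f U = Ultrafilter.map f V) {A : Set ℕ} (hA : A ∈ U) :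
    {y | ∃ x ∈ A, f x = f y} ∈ V := by
  have hU : f '' A ∈ Ultrafilter.map f U := by
    rw [Ultrafilter.mem_map]
    exact Filter.mem_of_superset hA (Set.subset_preimage_image f A)
  rw [h, Ultrafilter.mem_map] at hU
  exact hU

/-- Two finite-to-one functions admit a common `r` such that whenever one of them identifies
`x ≤ n` with `y`, we have `y ≤ r n`. -/
theorem FiniteToOne.exists_bound {f g : ℕ → ℕ} (hf : FiniteToOne f) (hg : FiniteToOne g) :
    ∃ r : ℕ → ℕ, ∀ n x y, x ≤ n → (f x = f y ∨ g x = g y) → y ≤ r n := by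
  have H : ∀ n, ∃ b, ∀ x y, x ≤ n → (f x = f y ∨ g x = g y) → y ≤ b := by
    intro n
    have hfin : (⋃ x ∈ Set.Iic n, (f ⁻¹' {f x} ∪ g ⁻¹' {g x})).Finite :=
      (Set.finite_Iic n).biUnion fun x _ => (hf (f x)).union (hg (g x))
    obtain ⟨b, hb⟩ := hfin.bddAbove
    refine ⟨b, fun x y hx hxy => hb ?_⟩
    simp only [Set.mem_iUnion]
    exact ⟨x, hx, hxy.imp Eq.symm Eq.symm⟩
  choose r hr using H
  exact ⟨r, hr⟩

/-- Two finite-to-one functions admit an interval partition of `ℕ`, with right endpoints `a n` and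
index function `p`, such that every fiber of either function meets only adjacent intervals. -/
theorem FiniteToOne.exists_interval_index {f g : ℕ → ℕ} (hf : FiniteToOne f)
    (hg : FiniteToOne g) :
    ∃ a p : ℕ → ℕ, StrictMono a ∧ (∀ x, x ≤ a (p x)) ∧
      ∀ x y, (f x = f y ∨ g x = g y) → p y ≤ p x + 1 := by
  obtain ⟨r, hr⟩ := hf.exists_bound hg
  let a : ℕ → ℕ := fun n => (fun k => max (r k) k + 1)^[n] 0
  have ha : ∀ n, a (n + 1) = max (r (a n)) (a n) + 1 := fun n =>
    Function.iterate_succ_apply' _ n 0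
  have hmono : StrictMono a := strictMono_nat_of_lt_succ fun n => by rw [ha]; omega
  have hex : ∀ x, ∃ n, x ≤ a n ∧ ∀ m, x ≤ a m → n ≤ m := fun x =>
    have h : ∃ n, x ≤ a n := ⟨x, hmono.le_apply⟩
    ⟨Nat.find h, Nat.find_spec h, fun _ hm => Nat.find_min' h hm⟩
  choose p hp hmin using hex
  refine ⟨a, p, hmono, hp, fun x y hxy => hmin y _ ?_⟩
  have := hr _ x y (hp x) hxy
  rw [ha]
  omega

/-- An ultrafilter concentrates, up to a shift of the index `p`, on any given residue class
modulo `5`; here the middle one. -/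
theorem exists_shift_residue_mem (U : Ultrafilter ℕ) (p : ℕ → ℕ) :
    ∃ e, {x | (p x + e) % 5 = 2} ∈ U := by
  have hcover : (⋃ e ∈ Set.Iio 5, {x | (p x + e) % 5 = 2}) ∈ U := by
    refine Filter.mem_of_superset Filter.univ_mem fun x _ => ?_
    simp only [Set.mem_iUnion]
    exact ⟨(7 - p x % 5) % 5, Nat.mod_lt _ (by norm_num), by simp only [Set.mem_ofPred_eq]; omega⟩
  obtain ⟨e, -, he⟩ := (Ultrafilter.finite_biUnion_mem_iff (Set.finite_Iio 5)).1 hcover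
  exact ⟨e, he⟩

theorem NearlyCoherent.symm {U V : Ultrafilter ℕ} (h : NearlyCoherent U V) :
    NearlyCoherent V U := by
  obtain ⟨f, hf, h⟩ := h
  exact ⟨f, hf, h.symm⟩

theorem NearlyCoherent.trans {U V W : Ultrafilter ℕ} (hUV : NearlyCoherent U V)
    (hVW : NearlyCoherent V W) : NearlyCoherent U W := by
  obtain ⟨f, hf, hUV⟩ := hUV
  obtain ⟨g, hg, hVW⟩ := hVW
  obtain ⟨a, p, ha, hap, hp⟩ := hf.exists_interval_index hg
  obtain ⟨e, he⟩ := exists_shift_residue_mem U p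
  refine ⟨fun x => (p x + e) / 5, fun m => ?_, ?_⟩
  · refine (Set.finite_Iic (a (5 * m + 5))).subset fun x hx => ?_
    have hx' : (p x + e) / 5 = m := hx
    exact (hap x).trans (ha.monotone (by omega))
  · symm
    refine Ultrafilter.coe_le_coe.1 fun B hB => ?_
    have hB' : (fun x => (p x + e) / 5) ⁻¹' B ∈ U := hB
    have hW := saturation_mem_of_map_eq hVW
      (saturation_mem_of_map_eq hUV (Filter.inter_mem hB' he))
    change (fun x => (p x + e) / 5) ⁻¹' B ∈ W
    refine Filter.mem_of_superset hW ?_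
    rintro z ⟨y, ⟨x, ⟨hxB, hxe⟩, hxy⟩, hyz⟩
    have h₁ := hp x y (Or.inl hxy)
    have h₂ := hp y x (Or.inl hxy.symm)
    have h₃ := hp y z (Or.inr hyz)
    have h₄ := hp z y (Or.inr hyz.symm)
    have hxe' : (p x + e) % 5 = 2 := hxe
    have hzx : (p z + e) / 5 = (p x + e) / 5 := by omega
    change (p z + e) / 5 ∈ B
    rw [hzx]
    exact hxB

/-- Blass: near coherence is an equivalence relation on free ultrafilters. -/
theorem nearCoherence_equivalence :
    (∀ U : Ultrafilter ℕ, FreeUf U → NearlyCoherent U U) ∧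
    (∀ U V : Ultrafilter ℕ, FreeUf U → FreeUf V →
      NearlyCoherent U V → NearlyCoherent V U) ∧
    (∀ U V W : Ultrafilter ℕ, FreeUf U → FreeUf V → FreeUf W →
      NearlyCoherent U V → NearlyCoherent V W → NearlyCoherent U W) := by
  exact ⟨fun U _ => ⟨id, fun m => Set.finite_singleton m, rfl⟩, fun _ _ _ _ h => h.symm,
    fun _ _ _ _ _ _ hUV hVW => hUV.trans hVW⟩
end

section
/- If there exists a sequence ⟨U_k : k ∈ ℕ⟩ of pairwise non-isomorphic Ramsey ultrafilters on ℕ, then there exists a family of cardinality 2^{ℵ₀} of pairwise non-isomorphic Q-points on ℕ × ℕ. -/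
/-- Q-point on a countably infinite type: free, and for every partition into
finite sets (fibers of a finite-to-one map to ℕ) some member meets each piece
in at most one point. -/
def IsQPointOn {S : Type} (U : Ultrafilter S) : Prop :=
  FreeUf U ∧ ∀ f : S → ℕ, (∀ m, (f ⁻¹' {m}).Finite) →
    ∃ A : Set S, A ∈ U ∧ Set.InjOn f A

/-- A P-point condition: every countable family of members has a pseudo-intersection that is
a member. -/
def HasPseudoIntersections {S : Type} (U : Ultrafilter S) : Prop :=
  ∀ D : ℕ → Set S, (∀ n, D n ∈ U) → ∃ E ∈ U, ∀ n, (E \ D n).Finite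

theorem FreeUf.compl_mem {S : Type} {U : Ultrafilter S} (hU : FreeUf U) {A : Set S}
    (hA : A.Finite) : Aᶜ ∈ U :=
  Ultrafilter.compl_mem_iff_notMem.2 fun h => hU A h hA

theorem FreeUf.map {S T : Type} {U : Ultrafilter S} (hU : FreeUf U) {f : S → T} {A : Set S}
    (hA : A ∈ U) (hf : Set.InjOn f A) : FreeUf (U.map f) := by
  intro C hC hfin
  refine hU (A ∩ f ⁻¹' C) (Filter.inter_mem hA hC) ?_
  refine Set.Finite.of_finite_image (f := f) (hfin.subset ?_) (hf.mono Set.inter_subset_left)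
  rintro _ ⟨x, hx, rfl⟩
  exact hx.2

theorem HasPseudoIntersections.map {S T : Type} {U : Ultrafilter S}
    (hU : HasPseudoIntersections U) (f : S → T) : HasPseudoIntersections (U.map f) := by
  intro D hD
  obtain ⟨E, hE, hfin⟩ := hU (fun n => f ⁻¹' D n) hD
  refine ⟨f '' E, Filter.image_mem_map hE, fun n => ((hfin n).image f).subset ?_⟩
  rintro _ ⟨⟨x, hx, rfl⟩, hn⟩
  exact ⟨x, ⟨hx, hn⟩, rfl⟩

theorem IsRamseyUf.hasPseudoIntersections {U : Ultrafilter ℕ} (hU : IsRamseyUf U) :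
    HasPseudoIntersections U := by
  classical
  intro D hD
  obtain ⟨A, hA, j, hj⟩ := hU.2 fun x y => if ∀ i ≤ x, y ∈ D i then 0 else 1
  have hinter : ∀ x, {y | ∀ i ≤ x, y ∈ D i} ∈ U := fun x =>
    (Filter.eventually_all_finite (Set.finite_Iic x)).2 fun i _ => hD i
  have hj0 : j = 0 := by
    obtain ⟨x, hx⟩ := (hU.1 A hA).nonempty
    obtain ⟨y, hy, hxy⟩ := (hU.1 _ (Filter.inter_mem hA (hinter x))).exists_gt x
    rw [← hj x hx y hy.1 hxy]
    exact if_pos hy.2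
  subst hj0
  refine ⟨A, hA, fun n => ?_⟩
  obtain ⟨x, hx, hnx⟩ := (hU.1 A hA).exists_gt n
  refine (Set.finite_Iic x).subset fun y hy => ?_
  by_contra hxy
  have hcol := hj x hx y hy.1 (not_le.1 hxy)
  by_cases h : ∀ i ≤ x, y ∈ D i
  · exact hy.2 (h n hnx.le)
  · simp [h] at hcol

/-- Pairwise distinct free P-points are simultaneously separated by disjoint members. -/
theorem exists_pairwise_disjoint_mem {S : Type} (V : ℕ → Ultrafilter S)
    (hfree : ∀ n, FreeUf (V n)) (hP : ∀ n, HasPseudoIntersections (V n))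
    (hV : Function.Injective V) :
    ∃ B : ℕ → Set S, (∀ n, B n ∈ V n) ∧ Pairwise (Function.onFun Disjoint B) := by
  have hsep : ∀ n m, ∃ s : Set S, s ∈ V n ∧ (n ≠ m → sᶜ ∈ V m) := by
    intro n m
    by_cases h : n = m
    · exact ⟨Set.univ, Filter.univ_mem, fun h' => absurd h h'⟩
    · obtain ⟨s, hs, hs'⟩ : ∃ s ∈ V n, s ∉ V m := by
        by_contra! hle
        exact h (hV (Ultrafilter.eq_of_le (g := V n) (f := V m) hle).symm)
      exact ⟨s, hs, fun _ => Ultrafilter.compl_mem_iff_notMem.2 hs'⟩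
  choose D hD hD' using hsep
  have hex : ∀ n, ∃ E ∈ V n, ∀ m, (E \ {x | x ∈ D n m ∧ (n ≠ m → x ∉ D m n)}).Finite := by
    intro n
    refine hP n _ fun m => ?_
    by_cases h : n = m
    · simpa [h] using hD m m
    · filter_upwards [hD n m, hD' m n (Ne.symm h)] with x hx hx'
      exact ⟨hx, fun _ => hx'⟩
  choose E hE hfin using hex
  have hEE : ∀ n m, n ≠ m → (E n ∩ E m).Finite := by
    intro n m h
    refine ((hfin n m).union (hfin m n)).subset fun x hx => ?_
    by_cases hx' : x ∈ D n m ∧ (n ≠ m → x ∉ D m n)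
    · exact Or.inr ⟨hx.2, fun h' => h'.2 h.symm hx'.1⟩
    · exact Or.inl ⟨hx.1, hx'⟩
  refine ⟨fun n => E n ∩ (⋃ m ∈ Set.Iio n, E n ∩ E m)ᶜ, fun n => ?_, ?_⟩
  · exact Filter.inter_mem (hE n) ((hfree n).compl_mem
      ((Set.finite_Iio n).biUnion fun m hm => hEE n m (ne_of_gt hm)))
  · have key : ∀ n m, m < n → Disjoint (E n ∩ (⋃ m ∈ Set.Iio n, E n ∩ E m)ᶜ) (E m) := by
      intro n m h
      refine Set.disjoint_left.2 fun x hx hxm => hx.2 ?_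
      exact Set.mem_biUnion (x := m) h ⟨hx.1, hxm⟩
    intro n m h
    rcases lt_or_gt_of_ne h with h | h
    · exact ((key m n h).mono_right Set.inter_subset_left).symm
    · exact (key n m h).mono_right Set.inter_subset_left

theorem FreeUf.exists_mem_subset_diff_infinite {S : Type} [Countable S] {U : Ultrafilter S}
    (hU : FreeUf U) {A : Set S} (hA : A ∈ U) : ∃ B ∈ U, B ⊆ A ∧ (A \ B).Infinite := by
  have : Infinite A := (hU A hA).to_subtype
  obtain ⟨e⟩ : Nonempty (ℕ ⊕ ℕ ≃ A) := nonempty_equiv_of_countable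
  let L : Set S := Set.range fun n => (e (Sum.inl n) : S)
  let R : Set S := Set.range fun n => (e (Sum.inr n) : S)
  have hL : L.Infinite := Set.infinite_range_of_injective
    (Subtype.val_injective.comp (e.injective.comp Sum.inl_injective))
  have hR : R.Infinite := Set.infinite_range_of_injective
    (Subtype.val_injective.comp (e.injective.comp Sum.inr_injective))
  have hdisj : Disjoint L R := by
    rw [Set.disjoint_left]
    rintro _ ⟨n, rfl⟩ ⟨m, hm⟩
    simpa using e.injective (Subtype.val_injective hm)
  have hLA : L ⊆ A := by rintro _ ⟨n, rfl⟩; exact (e _).2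
  have hRA : R ⊆ A := by rintro _ ⟨n, rfl⟩; exact (e _).2
  by_cases h : L ∈ U
  · exact ⟨L, h, hLA, hR.mono fun x hx => ⟨hRA hx, Set.disjoint_right.1 hdisj hx⟩⟩
  · exact ⟨A \ L, Filter.inter_mem hA (Ultrafilter.compl_mem_iff_notMem.2 h), Set.sdiff_subset,
      hL.mono fun x hx => ⟨hLA hx, fun h' => h'.2 hx⟩⟩

theorem ufIso_of_map_eq_map {S : Type} {U V : Ultrafilter ℕ} (hU : FreeUf U) {f g : ℕ → S}
    {A B : Set ℕ} (hA : A ∈ U) (hB : B ∈ V) (hf : Set.InjOn f A) (hg : Set.InjOn g B)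
    (h : U.map f = V.map g) : UfIso U V := by
  classical
  have hA' : A ∩ f ⁻¹' (g '' B) ∈ U := by
    refine Filter.inter_mem hA ?_
    have : g '' B ∈ U.map f := h ▸ Filter.image_mem_map hB
    exact this
  obtain ⟨A₁, hA₁, hsub, hinf⟩ := hU.exists_mem_subset_diff_infinite hA'
  choose! s hsB hs using fun x (hx : x ∈ A ∩ f ⁻¹' (g '' B)) => hx.2
  have hsinj : Set.InjOn s (A ∩ f ⁻¹' (g '' B)) := fun x hx y hy hxy =>
    hf hx.1 hy.1 (by rw [← hs x hx, ← hs y hy, hxy])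
  have hcA : Infinite {x // x ∉ A₁} := (hinf.mono fun x hx => hx.2).to_subtype
  have hcB : Infinite {x // x ∉ s '' A₁} := by
    refine ((hinf.image (hsinj.mono Set.sdiff_subset)).mono ?_).to_subtype
    rintro _ ⟨x, hx, rfl⟩ ⟨y, hy, hyx⟩
    exact hx.2 (hsinj (hsub hy) hx.1 hyx ▸ hy)
  obtain ⟨e'⟩ : Nonempty ({x // x ∉ A₁} ≃ {x // x ∉ s '' A₁}) := nonempty_equiv_of_countable
  let e : {x // x ∈ A₁} ≃ {x // x ∈ s '' A₁} := Equiv.Set.imageOfInjOn s A₁ (hsinj.mono hsub)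
  have he : ∀ x ∈ A₁, Equiv.subtypeCongr e e' x = s x := by
    intro x hx
    simp [Equiv.subtypeCongr, Equiv.sumCompl_symm_apply_of_pos, hx]
    rfl
  refine ⟨Equiv.subtypeCongr e e', Ultrafilter.eq_of_le fun C hC => ?_⟩
  have hgC : g '' (C ∩ B) ∈ U.map f := h ▸ Filter.image_mem_map (Filter.inter_mem hC hB)
  change Equiv.subtypeCongr e e' ⁻¹' C ∈ U
  filter_upwards [hA₁, hgC] with x hx hxC
  obtain ⟨y, hy, hyx⟩ := hxC
  have : s x = y := hg (hsB x (hsub hx)) hy.2 ((hs x (hsub hx)).trans hyx.symm)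
  change Equiv.subtypeCongr e e' x ∈ C
  rw [he x hx, this]
  exact hy.1

/-- The sum of the ultrafilters `V n`, placed on the columns of `ℕ × ℕ`, along `U`. -/
noncomputable def ultrafilterSum (U : Ultrafilter ℕ) (V : ℕ → Ultrafilter ℕ) :
    Ultrafilter (ℕ × ℕ) :=
  U.bind fun n => (V n).map (Prod.mk n)

theorem mem_ultrafilterSum {U : Ultrafilter ℕ} {V : ℕ → Ultrafilter ℕ} {X : Set (ℕ × ℕ)} :
    X ∈ ultrafilterSum U V ↔ ∀ᶠ n in U, Prod.mk n ⁻¹' X ∈ V n :=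
  Iff.rfl

theorem isQPointOn_ultrafilterSum (U : Ultrafilter ℕ) (V : ℕ → Ultrafilter ℕ)
    (hV : ∀ n, IsRamseyUf (V n)) (hpair : ∀ k l, k ≠ l → ¬ UfIso (V k) (V l)) :
    IsQPointOn (ultrafilterSum U V) := by
  refine ⟨fun X hX hfin => ?_, fun f hf => ?_⟩
  · obtain ⟨n, hn⟩ := (mem_ultrafilterSum.1 hX).exists
    exact (hV n).1 _ hn (hfin.preimage (Prod.mk_right_injective n).injOn)
  · have hinj : ∀ n, ∃ A ∈ V n, Set.InjOn (fun m => f (n, m)) A := fun n =>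
      (hV n).isQPointUf.2 _ fun m =>
        Set.Finite.preimage (f := Prod.mk n) (Prod.mk_right_injective n).injOn (hf m)
    choose A hA hAinj using hinj
    obtain ⟨B, hB, hdisj⟩ := exists_pairwise_disjoint_mem
      (fun n => (V n).map fun m => f (n, m)) (fun n => (hV n).1.map (hA n) (hAinj n))
      (fun n => (hV n).hasPseudoIntersections.map _) fun k l hkl => by
        by_contra hne
        exact hpair k l hne
          (ufIso_of_map_eq_map (hV k).1 (hA k) (hA l) (hAinj k) (hAinj l) hkl)
    refine ⟨{p | p.2 ∈ A p.1 ∧ f p ∈ B p.1},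
      mem_ultrafilterSum.2 (.of_forall fun n => Filter.inter_mem (hA n) (hB n)), ?_⟩
    rintro ⟨n, m⟩ ⟨hm, hmB⟩ ⟨n', m'⟩ ⟨hm', hmB'⟩ heq
    obtain rfl : n = n' := by
      by_contra hne
      exact Set.disjoint_left.1 (hdisj hne) hmB (by rw [heq]; exact hmB')
    exact congrArg (Prod.mk n) (hAinj n hm hm' heq)

theorem not_ufIso_ultrafilterSum {U : Ultrafilter ℕ} (hU : FreeUf U) (V W : ℕ → Ultrafilter ℕ)
    (hV : ∀ n, IsRamseyUf (V n)) (hW : ∀ n, IsRamseyUf (W n)) (N : ℕ)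
    (hVV : ∀ k l, k ≠ l → ¬ UfIso (V k) (V l)) (hWW : ∀ k l, k ≠ l → ¬ UfIso (W k) (W l))
    (hVW : ∀ k ≥ N, ∀ l ≥ N, ¬ UfIso (V k) (W l)) :
    ¬ UfIso (ultrafilterSum U V) (ultrafilterSum U W) := by
  rintro ⟨F, hF⟩
  have hev : ∀ᶠ n in U, N ≤ n :=
    Filter.mem_of_superset (hU.compl_mem (Set.finite_Iio N)) fun n (hn : ¬ n < N) => not_lt.1 hn
  let P : ℕ ⊕ ℕ → Ultrafilter ℕ := Sum.elim (fun n => V (n + N)) fun n => W (n + N)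
  let c : ℕ ⊕ ℕ → ℕ → ℕ × ℕ :=
    Sum.elim (fun n m => F (n + N, m)) fun n m => (n + N, m)
  have hc : ∀ i, Set.InjOn (c i) Set.univ := by
    rintro (n | n) x - y - h
    · exact (Prod.mk.inj (F.injective h)).2
    · exact (Prod.mk.inj h).2
  have hP : ∀ i, IsRamseyUf (P i) := by
    rintro (n | n)
    exacts [hV _, hW _]
  have hPinj : Function.Injective fun i => (P i).map (c i) := by
    intro i j hij
    have iso : UfIso (P i) (P j) := ufIso_of_map_eq_map (hP i).1 Filter.univ_mem
      Filter.univ_mem (hc i) (hc j) hij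
    have iso' : UfIso (P j) (P i) := ufIso_of_map_eq_map (hP j).1 Filter.univ_mem
      Filter.univ_mem (hc j) (hc i) hij.symm
    rcases i with n | n <;> rcases j with m | m
    · by_contra hne
      exact hVV (n + N) (m + N) (fun h => hne (by rw [Nat.add_right_cancel h])) iso
    · exact absurd iso (hVW _ (Nat.le_add_left _ _) _ (Nat.le_add_left _ _))
    · exact absurd iso' (hVW _ (Nat.le_add_left _ _) _ (Nat.le_add_left _ _))
    · by_contra hne
      exact hWW (n + N) (m + N) (fun h => hne (by rw [Nat.add_right_cancel h])) iso
  let E := Equiv.natSumNatEquivNat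
  obtain ⟨B, hB, hdisj⟩ := exists_pairwise_disjoint_mem
    (fun k => (P (E.symm k)).map (c (E.symm k)))
    (fun k => (hP _).1.map Filter.univ_mem (hc _))
    (fun k => (hP _).hasPseudoIntersections.map _) (hPinj.comp E.symm.injective)
  have hB' : ∀ i, c i ⁻¹' B (E i) ∈ P i := fun i => by
    have := hB (E i)
    simp only [Equiv.symm_apply_apply] at this
    exact this
  let X : Set (ℕ × ℕ) := ⋃ n, B (E (Sum.inl n))
  let Y : Set (ℕ × ℕ) := ⋃ n, B (E (Sum.inr n))
  have hX : X ∈ ultrafilterSum U W := by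
    rw [← hF]
    change F ⁻¹' X ∈ ultrafilterSum U V
    rw [mem_ultrafilterSum]
    filter_upwards [hev] with n hn
    obtain ⟨k, rfl⟩ := Nat.exists_eq_add_of_le' hn
    exact Filter.mem_of_superset (hB' (Sum.inl k)) fun m hm => Set.mem_iUnion.2 ⟨k, hm⟩
  have hY : Y ∈ ultrafilterSum U W := by
    rw [mem_ultrafilterSum]
    filter_upwards [hev] with n hn
    obtain ⟨k, rfl⟩ := Nat.exists_eq_add_of_le' hn
    exact Filter.mem_of_superset (hB' (Sum.inr k)) fun m hm => Set.mem_iUnion.2 ⟨k, hm⟩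
  obtain ⟨x, hxX, hxY⟩ := Ultrafilter.nonempty_of_mem (Filter.inter_mem hX hY)
  obtain ⟨n, hn⟩ := Set.mem_iUnion.1 hxX
  obtain ⟨m, hm⟩ := Set.mem_iUnion.1 hxY
  exact Set.disjoint_left.1 (hdisj fun h => Sum.inl_ne_inr (E.injective h)) hn hm

/-- The code of the restriction of `x` to the first `n` natural numbers. -/
def branchCode (x : ℕ → Bool) (n : ℕ) : ℕ := Encodable.encode ((List.range n).map x)

theorem branchCode_eq {x y : ℕ → Bool} {n m : ℕ} (h : branchCode x n = branchCode y m) :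
    n = m ∧ ∀ i < n, x i = y i := by
  have h' := Encodable.encode_injective h
  obtain rfl : n = m := by simpa using congrArg List.length h'
  exact ⟨rfl, fun i hi => List.map_inj_left.1 h' i (List.mem_range.2 hi)⟩

/-- If there are countably many pairwise non-isomorphic Ramsey ultrafilters
on ℕ, then there are `2^{ℵ₀}` pairwise non-isomorphic Q-points on ℕ × ℕ. -/
theorem continuum_many_qpoints (U : ℕ → Ultrafilter ℕ)
    (hU : ∀ k, IsRamseyUf (U k))
    (hpair : ∀ k l : ℕ, k ≠ l → ¬ UfIso (U k) (U l)) :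
    ∃ F : Set (Ultrafilter (ℕ × ℕ)),
      Cardinal.mk ↥F = Cardinal.continuum ∧
      (∀ V ∈ F, IsQPointOn V) ∧
      ∀ V ∈ F, ∀ W ∈ F, V ≠ W → ¬ UfIso V W := by
  let G : (ℕ → Bool) → Ultrafilter (ℕ × ℕ) := fun x =>
    ultrafilterSum (U 0) fun n => U (branchCode x n)
  have hbranch : ∀ x k l, k ≠ l → ¬ UfIso (U (branchCode x k)) (U (branchCode x l)) :=
    fun x k l hkl => hpair _ _ fun h => hkl (branchCode_eq h).1
  have hG : ∀ x y, x ≠ y → ¬ UfIso (G x) (G y) := by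
    intro x y hxy
    obtain ⟨i, hi⟩ := Function.ne_iff.1 hxy
    exact not_ufIso_ultrafilterSum (hU 0).1 _ _ (fun _ => hU _) (fun _ => hU _) (i + 1)
      (hbranch x) (hbranch y) fun k hk l _ => hpair _ _ fun h => hi ((branchCode_eq h).2 i hk)
  have hinj : Function.Injective G := fun x y hxy => by
    by_contra hne
    exact hG x y hne ⟨Equiv.refl _, by simpa using hxy⟩
  refine ⟨Set.range G, ?_, ?_, ?_⟩
  · rw [Cardinal.mk_range_eq G hinj]
    simp
  · rintro _ ⟨x, rfl⟩
    exact isQPointOn_ultrafilterSum _ _ (fun _ => hU _) (hbranch x)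
  · rintro _ ⟨x, rfl⟩ _ ⟨y, rfl⟩ hne
    exact hG x y fun h => hne (congrArg G h)
end

section
/- (Solomon, combinatorial form of 𝔟 ≤ 𝔲) Let U be a free ultrafilter on ℕ and let B ⊆ U be a filter basis generating U, i.e., every A ∈ U contains some B ∈ B (so every B ∈ B is infinite). For an infinite set B ⊆ ℕ, let e_B : ℕ → ℕ denote its increasing enumeration. Then the family {e_B : B ∈ B} is unbounded with respect to eventual domination: there is no g : ℕ → ℕ such that for every B ∈ B, e_B(n) ≤ g(n) holds for all but finitely many n. -/
/-- If `g` eventually dominates the enumeration of an infinite set `b`, and the sequence `h` satisfies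
`g (h k) < h (k + 1)`, then `b` meets all but finitely many of the intervals `[h k, h (k + 1))`. -/
theorem eventually_exists_mem_Ico_of_nth_le {b : Set ℕ} (hb : b.Infinite) {g h : ℕ → ℕ}
    (hh : StrictMono h) (hgh : ∀ k, g (h k) < h (k + 1))
    (hg : ∀ᶠ n in Filter.atTop, Nat.nth (· ∈ b) n ≤ g n) :
    ∀ᶠ k in Filter.atTop, ∃ x ∈ b, x ∈ Set.Ico (h k) (h (k + 1)) := by
  filter_upwards [hh.tendsto_atTop.eventually hg] with k hk
  exact ⟨Nat.nth (· ∈ b) (h k), Nat.nth_mem_of_infinite hb _,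
    (Nat.nth_strictMono hb).le_apply, hk.trans_lt (hgh k)⟩

/-- Solomon: the increasing enumerations of the members of any filter basis
generating a free ultrafilter form an unbounded family under eventual
domination. -/
theorem solomon_unbounded (U : Ultrafilter ℕ) (hU : FreeUf U)
    (B : Set (Set ℕ)) (hBU : ∀ b ∈ B, b ∈ U)
    (hgen : ∀ A : Set ℕ, A ∈ U → ∃ b ∈ B, b ⊆ A) :
    ¬ ∃ g : ℕ → ℕ, ∀ b ∈ B, ∀ᶠ n in Filter.atTop, Nat.nth (· ∈ b) n ≤ g n := by
  rintro ⟨g, hg⟩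
  obtain ⟨h, hh, hgh⟩ : ∃ h : ℕ → ℕ, StrictMono h ∧ ∀ k, g (h k) < h (k + 1) := by
    refine ⟨fun k => (fun x => max x (g x) + 1)^[k] 0, strictMono_nat_of_lt_succ fun k => ?_,
      fun k => ?_⟩ <;> simp only [Function.iterate_succ_apply'] <;> omega
  have key : ∀ b ∈ B, ∃ N, ∀ k ≥ N, ∃ x ∈ b, x ∈ Set.Ico (h k) (h (k + 1)) := fun b hb =>
    Filter.eventually_atTop.1
      (eventually_exists_mem_Ico_of_nth_le (hU b (hBU b hb)) hh hgh (hg b hb))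
  rcases U.mem_or_compl_mem {x | ∃ k, x ∈ Set.Ico (h (2 * k)) (h (2 * k + 1))} with hA | hA
  · obtain ⟨b, hb, hbA⟩ := hgen _ hA
    obtain ⟨N, hN⟩ := key b hb
    obtain ⟨x, hxb, hx⟩ := hN (2 * N + 1) (by omega)
    obtain ⟨j, hj⟩ := hbA hxb
    have h₁ : 2 * N + 1 < 2 * j + 1 := hh.lt_iff_lt.1 (hx.1.trans_lt hj.2)
    have h₂ : 2 * j < 2 * N + 1 + 1 := hh.lt_iff_lt.1 (hj.1.trans_lt hx.2)
    omega
  · obtain ⟨b, hb, hbA⟩ := hgen _ hA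
    obtain ⟨N, hN⟩ := key b hb
    obtain ⟨x, hxb, hx⟩ := hN (2 * N) (by omega)
    exact hbA hxb ⟨N, hx⟩
end
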